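/- arXiv:1703.02647 — 5 statements merged into one kernel-verified Lean document; each statement's English description precedes it below -/
import Mathlib

section
/- The set function f_k is nonnegative, monotone, and 0.5-weakly submodular for the integer |N_k| = 2k; that is, f_k(S) ≥ 0 for all S ⊆ N_k, f_k(A) ≤ f_k(B) whenever A ⊆ B ⊆ N_k, and for every pair of sets L, S ⊆ N_k it holds that ∑_{w ∈ S\L} (f_k(L∪{w}) − f_k(L)) ≥ 0.5 · (f_k(L∪S) − f_k(L)). -/
/-- Number of `u`-elements (left summands) in `S ⊆ N_k = Fin k ⊕ Fin k`. -/
def uC (k : ℕ) (S : Finset (Fin k ⊕ Fin k)) : ℕ :=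
  (S.filter (fun x => x.isLeft = true)).card

/-- Number of `v`-elements (right summands) in `S ⊆ N_k = Fin k ⊕ Fin k`. -/
def vC (k : ℕ) (S : Finset (Fin k ⊕ Fin k)) : ℕ :=
  (S.filter (fun x => x.isRight = true)).card

/-- The set function `f_k(S) = min(2·u(S) + 1, 2·v(S))`. -/
def fk (k : ℕ) (S : Finset (Fin k ⊕ Fin k)) : ℝ :=
  min (2 * (uC k S : ℝ) + 1) (2 * (vC k S : ℝ))

theorem uC_union (k : ℕ) (L S : Finset (Fin k ⊕ Fin k)) :
    uC k (L ∪ S) = uC k L + uC k (S \ L) := by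
  unfold uC
  rw [← Finset.union_sdiff_self_eq_union, Finset.filter_union, Finset.card_union_of_disjoint
    (Finset.disjoint_filter_filter Finset.disjoint_sdiff)]

theorem vC_union (k : ℕ) (L S : Finset (Fin k ⊕ Fin k)) :
    vC k (L ∪ S) = vC k L + vC k (S \ L) := by
  unfold vC
  rw [← Finset.union_sdiff_self_eq_union, Finset.filter_union, Finset.card_union_of_disjoint
    (Finset.disjoint_filter_filter Finset.disjoint_sdiff)]

theorem fk_mono (k : ℕ) {A B : Finset (Fin k ⊕ Fin k)} (h : A ⊆ B) : fk k A ≤ fk k B := by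
  unfold fk uC vC
  gcongr

/-- If `v(L) ≤ u(L)`, adding a new `v`-element raises `f_k` by at least one. -/
theorem one_le_fk_insert_inr_sub (k : ℕ) {L : Finset (Fin k ⊕ Fin k)} (h : vC k L ≤ uC k L)
    {j : Fin k} (hj : Sum.inr j ∉ L) : 1 ≤ fk k (insert (Sum.inr j) L) - fk k L := by
  have hu : uC k (insert (Sum.inr j) L) = uC k L := by simp [uC, Finset.filter_insert]
  have hv : vC k (insert (Sum.inr j) L) = vC k L + 1 := by
    simp [vC, Finset.filter_insert, hj]
  have h' : (vC k L : ℝ) ≤ uC k L := by exact_mod_cast h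
  rw [le_sub_iff_add_le]
  unfold fk
  rw [hu, hv, min_eq_right (by linarith : 2 * (vC k L : ℝ) ≤ 2 * (uC k L : ℝ) + 1)]
  push_cast
  exact le_min (by linarith) (by linarith)

/-- If `u(L) < v(L)`, adding a new `u`-element raises `f_k` by at least one. -/
theorem one_le_fk_insert_inl_sub (k : ℕ) {L : Finset (Fin k ⊕ Fin k)} (h : uC k L < vC k L)
    {i : Fin k} (hi : Sum.inl i ∉ L) : 1 ≤ fk k (insert (Sum.inl i) L) - fk k L := by
  have hu : uC k (insert (Sum.inl i) L) = uC k L + 1 := by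
    simp [uC, Finset.filter_insert, hi]
  have hv : vC k (insert (Sum.inl i) L) = vC k L := by simp [vC, Finset.filter_insert]
  have h' : (uC k L : ℝ) + 1 ≤ vC k L := by exact_mod_cast h
  rw [le_sub_iff_add_le]
  unfold fk
  rw [hu, hv, min_eq_left (by linarith : 2 * (uC k L : ℝ) + 1 ≤ 2 * (vC k L : ℝ))]
  push_cast
  exact le_min (by linarith) (by linarith)

theorem fk_union_sub_le_sum (k : ℕ) (L S : Finset (Fin k ⊕ Fin k)) :
    (0.5 : ℝ) * (fk k (L ∪ S) - fk k L) ≤ ∑ w ∈ S \ L, (fk k (insert w L) - fk k L) := by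
  have gain_nonneg (w) : 0 ≤ fk k (insert w L) - fk k L :=
    sub_nonneg.2 (fk_mono k (Finset.subset_insert w L))
  rcases le_or_gt (vC k L) (uC k L) with h | h
  · have hsum : (vC k (S \ L) : ℝ) ≤ ∑ w ∈ S \ L, (fk k (insert w L) - fk k L) := by
      rw [vC, Finset.card_filter, Nat.cast_sum]
      refine Finset.sum_le_sum fun w hw => ?_
      have hwL := (Finset.mem_sdiff.1 hw).2
      cases w with
      | inl i => simpa using gain_nonneg (Sum.inl i)
      | inr j => simpa using one_le_fk_insert_inr_sub k h hwL
    have hL : fk k L = 2 * (vC k L : ℝ) := by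
      have h' : (vC k L : ℝ) ≤ uC k L := by exact_mod_cast h
      exact min_eq_right (by linarith)
    have hLS : fk k (L ∪ S) ≤ 2 * (vC k (L ∪ S) : ℝ) := min_le_right _ _
    rw [vC_union, Nat.cast_add] at hLS
    linarith
  · have hsum : (uC k (S \ L) : ℝ) ≤ ∑ w ∈ S \ L, (fk k (insert w L) - fk k L) := by
      rw [uC, Finset.card_filter, Nat.cast_sum]
      refine Finset.sum_le_sum fun w hw => ?_
      have hwL := (Finset.mem_sdiff.1 hw).2
      cases w with
      | inl i => simpa using one_le_fk_insert_inl_sub k h hwL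
      | inr j => simpa using gain_nonneg (Sum.inr j)
    have hL : fk k L = 2 * (uC k L : ℝ) + 1 := by
      have h' : (uC k L : ℝ) + 1 ≤ vC k L := by exact_mod_cast h
      exact min_eq_left (by linarith)
    have hLS : fk k (L ∪ S) ≤ 2 * (uC k (L ∪ S) : ℝ) + 1 := min_le_left _ _
    rw [uC_union, Nat.cast_add] at hLS
    linarith

/-- `f_k` is nonnegative, monotone, and `0.5`-weakly submodular for the integer `|N_k| = 2k`. -/
theorem fk_nonneg_monotone_weakly_submodular (k : ℕ) (hk : 1 ≤ k) :
    (∀ S : Finset (Fin k ⊕ Fin k), 0 ≤ fk k S) ∧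
    (∀ A B : Finset (Fin k ⊕ Fin k), A ⊆ B → fk k A ≤ fk k B) ∧
    (∀ L S : Finset (Fin k ⊕ Fin k),
      (0.5 : ℝ) * (fk k (L ∪ S) - fk k L) ≤ ∑ w ∈ S \ L, (fk k (insert w L) - fk k L)) :=
  ⟨fun _ => le_min (by positivity) (by positivity), fun _ _ => fk_mono k,
    fk_union_sub_le_sum k⟩
end

section
/- Let f be a nonnegative, monotone, γ-weakly submodular set function for the integer k with 0 < γ ≤ 1, and let OPT be a set of size k. Then for every 0 ≤ i ≤ k, the average of f over all subsets of OPT of cardinality i satisfies (1/C(k,i)) · ∑_{T ⊆ OPT, |T| = i} f(T) ≥ [1 − (1 − γ/k)^i] · f(OPT), where C(k,i) is the binomial coefficient. (Equivalently, if OPT_i is a uniformly random subset of OPT of size i, then E[f(OPT_i)] ≥ [1 − (1 − γ/k)^i] · f(OPT).) -/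
open Finset in
/-- Double counting: each set of size `i + 1` arises from exactly `i + 1` pairs of a set of
size `i` and a new element. -/
theorem sum_powersetCard_sum_insert {α : Type*} [DecidableEq α] (f : Finset α → ℝ)
    (s : Finset α) (i : ℕ) :
    ∑ T ∈ s.powersetCard i, ∑ j ∈ s \ T, f (insert j T) =
      ((i : ℝ) + 1) * ∑ U ∈ s.powersetCard (i + 1), f U := by
  have h : ((i : ℝ) + 1) * ∑ U ∈ s.powersetCard (i + 1), f U =
      ∑ U ∈ s.powersetCard (i + 1), ∑ _j ∈ U, f U := by
    rw [mul_sum]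
    refine sum_congr rfl fun U hU => ?_
    rw [sum_const, (mem_powersetCard.1 hU).2, nsmul_eq_mul]
    push_cast
    ring
  rw [h, sum_sigma', sum_sigma']
  refine sum_bij' (fun p _ => ⟨insert p.2 p.1, p.2⟩) (fun p _ => ⟨p.1.erase p.2, p.2⟩)
    ?_ ?_ ?_ ?_ ?_
  · rintro ⟨T, j⟩ hp
    simp only [mem_sigma, mem_powersetCard, mem_sdiff] at hp ⊢
    exact ⟨⟨insert_subset hp.2.1 hp.1.1, by rw [card_insert_of_notMem hp.2.2, hp.1.2]⟩,
      mem_insert_self _ _⟩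
  · rintro ⟨U, j⟩ hp
    simp only [mem_sigma, mem_powersetCard, mem_sdiff] at hp ⊢
    refine ⟨⟨(erase_subset _ _).trans hp.1.1, ?_⟩, hp.1.1 hp.2, notMem_erase _ _⟩
    rw [card_erase_of_mem hp.2, hp.1.2, Nat.add_sub_cancel]
  · rintro ⟨T, j⟩ hp
    simp only [mem_sigma, mem_sdiff] at hp
    simp only [erase_insert hp.2.2]
  · rintro ⟨U, j⟩ hp
    simp only [mem_sigma] at hp
    simp only [insert_erase hp.2]
  · rintro ⟨T, j⟩ _
    rfl

/-- For a nonnegative, monotone, `γ`-weakly submodular (for `k`) set function and `OPT` of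
size `k`, the average of `f` over the subsets of `OPT` of size `i` (i.e. the expectation of
`f` at a uniformly random size-`i` subset of `OPT`) is at least `[1 − (1 − γ/k)^i]·f(OPT)`. -/
theorem expected_value_random_subset {α : Type*} [DecidableEq α] (f : Finset α → ℝ)
    (γ : ℝ) (k : ℕ) (hγ0 : 0 < γ) (hγ1 : γ ≤ 1)
    (hnonneg : ∀ A : Finset α, 0 ≤ f A)
    (hmono : ∀ A B : Finset α, A ⊆ B → f A ≤ f B)
    (hws : ∀ L S : Finset α, L.card ≤ k → (S \ L).card ≤ k →
      γ * (f (L ∪ S) - f L) ≤ ∑ j ∈ S \ L, (f (insert j L) - f L))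
    (OPT : Finset α) (hOPT : OPT.card = k) :
    ∀ i : ℕ, i ≤ k →
      (1 - (1 - γ / k) ^ i) * f OPT ≤
        (1 / (k.choose i : ℝ)) * ∑ T ∈ OPT.powersetCard i, f T := by
  intro i
  induction i with
  | zero => intro _; simpa using hnonneg ∅
  | succ i ih =>
    intro hi
    have ih := ih (by omega)
    have hik : (0 : ℝ) < k - i := by
      have : (i : ℝ) + 1 ≤ k := by exact_mod_cast hi
      linarith
    have hk : (0 : ℝ) < k := hik.trans_le (by simp)
    have hc : (0 : ℝ) < k.choose i := by exact_mod_cast Nat.choose_pos (by omega)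
    have hc' : (0 : ℝ) < k.choose (i + 1) := by exact_mod_cast Nat.choose_pos hi
    have hcc : (k.choose (i + 1) : ℝ) * (i + 1) = k.choose i * (k - i) := by
      have := Nat.choose_succ_right_eq k i
      rw [← Nat.cast_sub (by omega : i ≤ k)]
      exact_mod_cast this
    have hcard : ((OPT.powersetCard i).card : ℝ) = k.choose i := by
      rw [Finset.card_powersetCard, hOPT]
    set A := ∑ T ∈ OPT.powersetCard i, f T with hA
    set B := ∑ T ∈ OPT.powersetCard (i + 1), f T with hB
    have hAle : A ≤ k.choose i * f OPT := by
      rw [← hcard, ← nsmul_eq_mul]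
      exact Finset.sum_le_card_nsmul _ _ _ fun T hT =>
        hmono _ _ (Finset.mem_powersetCard.1 hT).1
    have hstep : (k - i - γ) * A + γ * (k.choose i * f OPT) ≤ (i + 1) * B := by
      rw [hB, ← sum_powersetCard_sum_insert, hA, ← hcard, Finset.mul_sum, ← nsmul_eq_mul,
        ← Finset.sum_const, Finset.mul_sum, ← Finset.sum_add_distrib]
      refine Finset.sum_le_sum fun T hT => ?_
      obtain ⟨hTs, hTc⟩ := Finset.mem_powersetCard.1 hT
      have hd : ((OPT \ T).card : ℝ) = k - i := by
        rw [Finset.card_sdiff_of_subset hTs, hOPT, hTc, Nat.cast_sub (by omega)]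
      have h := hws T OPT (by omega) (hOPT ▸ Finset.card_le_card Finset.sdiff_subset)
      rw [Finset.union_eq_right.2 hTs, Finset.sum_sub_distrib, Finset.sum_const,
        nsmul_eq_mul, hd] at h
      linarith
    have havg : 1 / (k.choose (i + 1) : ℝ) * B =
        (i + 1) * B / (k.choose i * (k - i)) := by
      rw [← hcc]
      field_simp
    set a := 1 / (k.choose i : ℝ) * A with ha
    have hAa : A = k.choose i * a := by rw [ha]; field_simp
    have haF : a ≤ f OPT := by
      rw [hAa] at hAle
      exact le_of_mul_le_mul_left hAle hc
    have hrec : a + γ / (k - i) * (f OPT - a) ≤ 1 / (k.choose (i + 1) : ℝ) * B := by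
      rw [havg, le_div_iff₀ (by positivity)]
      refine le_trans (le_of_eq ?_) hstep
      rw [hAa]
      field_simp
      ring
    have hdiv : γ / k ≤ γ / (k - i) :=
      div_le_div_of_nonneg_left hγ0.le hik (by simp)
    have hmul := mul_le_mul_of_nonneg_right hdiv (sub_nonneg.2 haF)
    have hq : 0 ≤ 1 - γ / k := by
      have : (1 : ℝ) ≤ k := by exact_mod_cast (by omega : 1 ≤ k)
      rw [sub_nonneg, div_le_one hk]
      linarith
    have hih := mul_le_mul_of_nonneg_left ih hq
    rw [pow_succ]
    linarith
end

section
/- Let f be a nonnegative, monotone, γ-weakly submodular set function for the integer k with 0 < γ ≤ 1, let OPT be a set of size k, and let T ⊆ OPT be a proper subset (|T| < k). Then the average value of f(T∪{u}) over the elements u ∈ OPT\T satisfies (1/|OPT\T|) · ∑_{u ∈ OPT\T} f(T∪{u}) ≥ (1 − γ/k)·f(T) + (γ/k)·f(OPT). -/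
/-- For a nonnegative, monotone, `γ`-weakly submodular (for `k`) set function, `OPT` of size
`k` and a proper subset `T ⊆ OPT`, the average of `f(T ∪ {u})` over `u ∈ OPT \ T` is at least
`(1 − γ/k)·f(T) + (γ/k)·f(OPT)`. -/
theorem expected_value_add_random_element {α : Type*} [DecidableEq α] (f : Finset α → ℝ)
    (γ : ℝ) (k : ℕ) (hγ0 : 0 < γ) (hγ1 : γ ≤ 1)
    (hnonneg : ∀ A : Finset α, 0 ≤ f A)
    (hmono : ∀ A B : Finset α, A ⊆ B → f A ≤ f B)
    (hws : ∀ L S : Finset α, L.card ≤ k → (S \ L).card ≤ k →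
      γ * (f (L ∪ S) - f L) ≤ ∑ j ∈ S \ L, (f (insert j L) - f L))
    (OPT : Finset α) (hOPT : OPT.card = k)
    (T : Finset α) (hT : T ⊆ OPT) (hTcard : T.card < k) :
    (1 - γ / k) * f T + (γ / k) * f OPT ≤
      (1 / ((OPT \ T).card : ℝ)) * ∑ u ∈ OPT \ T, f (insert u T) := by
  have hle : (OPT \ T).card ≤ k := hOPT ▸ Finset.card_le_card Finset.sdiff_subset
  have hpos : 0 < (OPT \ T).card := by
    rw [Finset.card_sdiff_of_subset hT]
    omega
  have hgain := hws T OPT hTcard.le hle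
  rw [Finset.union_eq_right.mpr hT, Finset.sum_sub_distrib, Finset.sum_const,
    nsmul_eq_mul] at hgain
  have hm : (0 : ℝ) < (OPT \ T).card := by exact_mod_cast hpos
  have hmk : ((OPT \ T).card : ℝ) ≤ k := by exact_mod_cast hle
  have hD : 0 ≤ γ * (f OPT - f T) :=
    mul_nonneg hγ0.le (sub_nonneg.mpr (hmono T OPT hT))
  calc (1 - γ / k) * f T + (γ / k) * f OPT = f T + γ * (f OPT - f T) / k := by ring
    _ ≤ f T + γ * (f OPT - f T) / (OPT \ T).card := by gcongr
    _ = (1 / ((OPT \ T).card : ℝ)) * ((OPT \ T).card * f T + γ * (f OPT - f T)) := by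
      field_simp
    _ ≤ (1 / ((OPT \ T).card : ℝ)) * ∑ u ∈ OPT \ T, f (insert u T) := by
      gcongr
      linarith
end

section
/- Let f be a monotone, γ-weakly submodular set function for the integer k with γ > 0, let S be a set with |S| ≤ k, and let T be a nonempty set with |T| ≤ k. Then the average marginal contribution of the elements of T to S satisfies (1/|T|) · ∑_{u ∈ T} (f(S∪{u}) − f(S)) ≥ (γ/k) · (f(T) − f(S)). -/
/-- For a monotone, `γ`-weakly submodular (for `k`) set function, a set `S` with `|S| ≤ k`
and a nonempty set `T` with `|T| ≤ k`, the average marginal contribution of the elements of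
`T` to `S` is at least `(γ/k)·(f(T) − f(S))`. -/
theorem average_marginal_contribution {α : Type*} [DecidableEq α] (f : Finset α → ℝ)
    (γ : ℝ) (k : ℕ) (hγ0 : 0 < γ)
    (hmono : ∀ A B : Finset α, A ⊆ B → f A ≤ f B)
    (hws : ∀ L S : Finset α, L.card ≤ k → (S \ L).card ≤ k →
      γ * (f (L ∪ S) - f L) ≤ ∑ j ∈ S \ L, (f (insert j L) - f L))
    (S T : Finset α) (hS : S.card ≤ k) (hTne : T.Nonempty) (hT : T.card ≤ k) :
    (γ / k) * (f T - f S) ≤ (1 / (T.card : ℝ)) * ∑ u ∈ T, (f (insert u S) - f S) := by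
  have hnonneg : ∀ u ∈ T, 0 ≤ f (insert u S) - f S := fun u _ =>
    sub_nonneg.2 (hmono _ _ (Finset.subset_insert u S))
  have hsum : γ * (f T - f S) ≤ ∑ u ∈ T, (f (insert u S) - f S) :=
    calc γ * (f T - f S) ≤ γ * (f (S ∪ T) - f S) := by
          have := hmono T (S ∪ T) Finset.subset_union_right
          gcongr
      _ ≤ ∑ u ∈ T \ S, (f (insert u S) - f S) :=
          hws S T hS ((Finset.card_le_card Finset.sdiff_subset).trans hT)
      _ ≤ ∑ u ∈ T, (f (insert u S) - f S) :=
          Finset.sum_le_sum_of_subset_of_nonneg Finset.sdiff_subset fun u hu _ => hnonneg u hu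
  have hTpos : (0 : ℝ) < T.card := by exact_mod_cast hTne.card_pos
  have hTk : (T.card : ℝ) ≤ k := by exact_mod_cast hT
  calc (γ / k) * (f T - f S) = (1 / (k : ℝ)) * (γ * (f T - f S)) := by ring
    _ ≤ (1 / (k : ℝ)) * ∑ u ∈ T, (f (insert u S) - f S) :=
        mul_le_mul_of_nonneg_left hsum (by positivity)
    _ ≤ (1 / (T.card : ℝ)) * ∑ u ∈ T, (f (insert u S) - f S) :=
        mul_le_mul_of_nonneg_right (one_div_le_one_div_of_le hTpos hTk)
          (Finset.sum_nonneg hnonneg)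
end

section
/- Let γ ∈ (0,1], set γ' = e^{−γ/2} and a = (√(2 − γ') − 1)/2. Let F ≥ 0 and let τ be a real number with 0 ≤ τ ≤ a·γ·F. Then for every p ∈ [0,1], max{ (1 − p)·τ , (1/2)·(γ·(p − γ')·F − 2τ) } ≥ τ·(√(2 − γ') − 1). (This is the deterministic inequality underlying the guarantee that Threshold Greedy run with threshold τ ≤ aγ·f(OPT) returns a set of expected value at least τ·(√(2 − e^{−γ/2}) − 1).) -/
/-- Deterministic inequality underlying the Threshold Greedy guarantee: with
`γ' = e^{−γ/2}`, `a = (√(2 − γ') − 1)/2`, `F ≥ 0`, `0 ≤ τ ≤ a·γ·F` and any `p ∈ [0,1]`,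
`max{(1 − p)·τ, (1/2)·(γ·(p − γ')·F − 2τ)} ≥ τ·(√(2 − γ') − 1)`. -/
theorem threshold_greedy_guarantee (γ γ' a F τ p : ℝ)
    (hγ0 : 0 < γ) (hγ1 : γ ≤ 1)
    (hγ' : γ' = Real.exp (-(γ / 2)))
    (ha : a = (Real.sqrt (2 - γ') - 1) / 2)
    (hF : 0 ≤ F) (hτ0 : 0 ≤ τ) (hτ : τ ≤ a * γ * F)
    (hp0 : 0 ≤ p) (hp1 : p ≤ 1) :
    τ * (Real.sqrt (2 - γ') - 1) ≤
      max ((1 - p) * τ) ((1 / 2) * (γ * (p - γ') * F - 2 * τ)) := by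
  have hγ'1 : γ' < 1 := by
    rw [hγ', Real.exp_lt_one_iff]
    linarith
  have hs0 : 0 ≤ Real.sqrt (2 - γ') := Real.sqrt_nonneg _
  have hsq : Real.sqrt (2 - γ') ^ 2 = 2 - γ' := Real.sq_sqrt (by linarith)
  generalize Real.sqrt (2 - γ') = s at *
  subst ha
  rcases le_total p (2 - s) with hp | hp
  · refine le_max_of_le_left ?_
    nlinarith [mul_nonneg hτ0 (sub_nonneg.2 hp)]
  · refine le_max_of_le_right ?_
    have h₁ : γ * F * (s ^ 2 - s) ≤ γ * F * (p - γ') :=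
      mul_le_mul_of_nonneg_left (by linarith) (mul_nonneg hγ0.le hF)
    have h₂ : s * τ ≤ s * ((s - 1) / 2 * γ * F) := mul_le_mul_of_nonneg_left hτ hs0
    linarith
end
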